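/- Let X be a Polish space with metric d, C ⊆ X compact, and F: C × P(C) → R continuous. Assume: (i) F is monotone and satisfies the unique minimizer condition; (ii) F is Lipschitz on C × P(C) (with P(C) endowed with d_1) and there is a constant K > 0 such that |F(x1,η1) − F(x1,η2) − F(x2,η1) + F(x2,η2)| ≤ K d(x1,x2) d_1(η1,η2) for all x1, x2 ∈ C and η1, η2 ∈ P(C). Then there exists x̃ ∈ C such that δ_{x̃} is the unique equilibrium of F, and the fictitious play sequence (x_n, η̄_n) converges to (x̃, δ_{x̃}) (with η̄_n → δ_{x̃} in d_1). -/

import Mathlib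

open MeasureTheory Filter Topology
open scoped ENNReal

noncomputable section

/-- The Kantorovich–Rubinstein (Wasserstein-1) distance between two measures,
defined as the infimum over couplings of the integral of the distance. -/
def W1 {X : Type*} [MeasurableSpace X] [PseudoMetricSpace X] (μ ν : Measure X) : ℝ :=
  sInf {r : ℝ | ∃ γ : Measure (X × X), γ.map Prod.fst = μ ∧ γ.map Prod.snd = ν ∧
    r = ∫ p, dist p.1 p.2 ∂γ}

/-- The topological support of a measure. -/
def msupp {X : Type*} [TopologicalSpace X] [MeasurableSpace X] (μ : Measure X) : Set X :=
  {x | ∀ U : Set X, IsOpen U → x ∈ U → 0 < μ U}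

variable {X : Type*} [MetricSpace X] [CompleteSpace X] [TopologicalSpace.SeparableSpace X]
  [MeasurableSpace X] [BorelSpace X]

/-- The set of (Borel) probability measures concentrated on `C`, identified with `P(C)`. -/
def PC (C : Set X) : Set (ProbabilityMeasure X) := {η | (η : Measure X) Cᶜ = 0}

/-- `η` is an equilibrium for `F` on `C`: it is concentrated on `C`, and its support is
contained in the set of minimizers of `F (·, η)` over `C`. -/
def IsEquilibrium (F : X → ProbabilityMeasure X → ℝ) (C : Set X)
    (η : ProbabilityMeasure X) : Prop :=
  η ∈ PC C ∧ msupp (η : Measure X) ⊆ {x | x ∈ C ∧ ∀ y ∈ C, F x η ≤ F y η}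

/-- `F` is monotone: `∫ (F(x,μ) − F(x,ν)) d(μ−ν)(x) ≥ 0` for all `μ, ν ∈ P(C)`. -/
def MonotoneMFG (F : X → ProbabilityMeasure X → ℝ) (C : Set X) : Prop :=
  ∀ μ ∈ PC C, ∀ ν ∈ PC C,
    0 ≤ (∫ x, (F x μ - F x ν) ∂(μ : Measure X)) - ∫ x, (F x μ - F x ν) ∂(ν : Measure X)

/-- The unique minimizer condition: for every `η ∈ P(C)` the problem
`inf_{x ∈ C} F (x, η)` has a unique solution. -/
def UniqueMinimizerCondition (F : X → ProbabilityMeasure X → ℝ) (C : Set X) : Prop :=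
  ∀ η ∈ PC C, ∃! x, x ∈ C ∧ ∀ y ∈ C, F x η ≤ F y η

set_option linter.unusedSectionVars false

section Integration

variable {C : Set X}

lemma ae_mem_of_mem_PC {μ : ProbabilityMeasure X} (hμ : μ ∈ PC C) :
    ∀ᵐ y ∂(μ : Measure X), y ∈ C := hμ

lemma isCompact_PC (hC : IsCompact C) : IsCompact (PC C) := by
  have h := isCompact_setOfPred_probabilityMeasure_mass_eq_compl_isCompact_le
    (u := fun _ => 0) (K := fun _ => C) tendsto_const_nhds (fun _ => hC) (Or.inr monotone_const)
  convert h using 1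
  ext μ
  simp [PC, ProbabilityMeasure.null_iff_toMeasure_null]

lemma integrable_of_continuousOn (hC : IsCompact C) {f : X → ℝ} (hf : ContinuousOn f C)
    {μ : ProbabilityMeasure X} (hμ : μ ∈ PC C) : Integrable f (μ : Measure X) := by
  have h : IntegrableOn f C (μ : Measure X) := hf.integrableOn_compact hC
  rwa [IntegrableOn, Measure.restrict_eq_self_of_ae_mem (ae_mem_of_mem_PC hμ)] at h

lemma tendsto_integral_of_continuousOn (hC : IsCompact C) {f : X → ℝ} (hf : ContinuousOn f C)
    {ι : Type*} {l : Filter ι} {m : ι → ProbabilityMeasure X} {μ : ProbabilityMeasure X}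
    (hm : ∀ᶠ i in l, m i ∈ PC C) (hμ : μ ∈ PC C) (h : Tendsto m l (𝓝 μ)) :
    Tendsto (fun i => ∫ y, f y ∂(m i : Measure X)) l (𝓝 (∫ y, f y ∂(μ : Measure X))) := by
  have : CompactSpace C := isCompact_iff_compactSpace.1 hC
  obtain ⟨g, -, hg⟩ := BoundedContinuousFunction.exists_norm_eq_domRestrict_eq_of_closed
    (BoundedContinuousFunction.mkOfCompact ⟨C.domRestrict f, hf.domRestrict⟩) hC.isClosed
  have hgf : ∀ y ∈ C, g y = f y := fun y hy => by
    simpa using! DFunLike.congr_fun hg ⟨y, hy⟩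
  have key : ∀ ν ∈ PC C, ∫ y, g y ∂(ν : Measure X) = ∫ y, f y ∂(ν : Measure X) := fun ν hν =>
    integral_congr_ae ((ae_mem_of_mem_PC hν).mono hgf)
  rw [← key μ hμ]
  exact (ProbabilityMeasure.tendsto_iff_forall_integral_tendsto.1 h g).congr'
    (hm.mono fun i hi => key _ hi)

end Integration

section Wasserstein

lemma W1_nonneg (μ ν : Measure X) : 0 ≤ W1 μ ν := by
  refine Real.sInf_nonneg ?_
  rintro r ⟨γ, -, -, rfl⟩
  exact integral_nonneg fun _ => dist_nonneg

lemma W1_le_of_coupling {μ ν : Measure X} (γ : Measure (X × X)) (h₁ : γ.map Prod.fst = μ)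
    (h₂ : γ.map Prod.snd = ν) : W1 μ ν ≤ ∫ p, dist p.1 p.2 ∂γ := by
  refine csInf_le ⟨0, ?_⟩ ⟨γ, h₁, h₂, rfl⟩
  rintro r ⟨γ, -, -, rfl⟩
  exact integral_nonneg fun _ => dist_nonneg

/-- Moving a fraction `s` of the mass of `μ` to a point `p` costs at most `s` times the mean
distance to `p`. -/
lemma W1_mixture_dirac_le {μ : Measure X} [IsProbabilityMeasure μ] {t s : ℝ≥0∞} (hts : t + s = 1)
    {p : X} (hint : Integrable (fun y => dist y p) μ) :
    W1 μ (t • μ + s • Measure.dirac p) ≤ s.toReal * ∫ y, dist y p ∂μ := by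
  have : SecondCountableTopology X := UniformSpace.secondCountable_of_separable X
  have ht : t ≠ ∞ := fun h => by simp [h] at hts
  have hs : s ≠ ∞ := fun h => by simp [h] at hts
  have hd : Measurable fun y : X => (y, y) := by fun_prop
  have hp : Measurable fun y : X => (y, p) := by fun_prop
  have hdist : StronglyMeasurable fun q : X × X => dist q.1 q.2 :=
    continuous_dist.stronglyMeasurable
  refine (W1_le_of_coupling (t • μ.map (fun y => (y, y)) + s • μ.map (fun y => (y, p)))
    ?_ ?_).trans_eq ?_
  · rw [Measure.map_add _ _ measurable_fst, Measure.map_smul, Measure.map_smul,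
      Measure.map_map measurable_fst hd, Measure.map_map measurable_fst hp]
    simp [Function.comp_def, ← add_smul, hts]
  · rw [Measure.map_add _ _ measurable_snd, Measure.map_smul, Measure.map_smul,
      Measure.map_map measurable_snd hd, Measure.map_map measurable_snd hp]
    simp [Function.comp_def]
  · rw [integral_add_measure, integral_smul_measure, integral_smul_measure,
      integral_map hd.aemeasurable hdist.aestronglyMeasurable,
      integral_map hp.aemeasurable hdist.aestronglyMeasurable]
    · simp
    · refine Integrable.smul_measure ?_ ht
      rw [integrable_map_measure hdist.aestronglyMeasurable hd.aemeasurable]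
      simp [Function.comp_def]
    · refine Integrable.smul_measure ?_ hs
      rw [integrable_map_measure hdist.aestronglyMeasurable hp.aemeasurable]
      exact hint

lemma integral_mixture_dirac {μ : Measure X} {t s : ℝ≥0∞} (ht : t ≠ ∞) (hs : s ≠ ∞) {p : X}
    {f : X → ℝ} (hf : Integrable f μ) :
    ∫ y, f y ∂(t • μ + s • Measure.dirac p) = t.toReal * ∫ y, f y ∂μ + s.toReal * f p := by
  rw [integral_add_measure (hf.smul_measure ht)
      ((integrable_dirac (by simp)).smul_measure hs),
    integral_smul_measure, integral_smul_measure, integral_dirac]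
  simp

end Wasserstein

section Equilibrium

variable {C : Set X} {F : X → ProbabilityMeasure X → ℝ}

/-- The minimizers of `F (·, η)` over `C`. -/
def argminSet (F : X → ProbabilityMeasure X → ℝ) (C : Set X) (η : ProbabilityMeasure X) : Set X :=
  {x | x ∈ C ∧ ∀ y ∈ C, F x η ≤ F y η}

lemma msupp_eq_support (μ : Measure X) : msupp μ = μ.support := by
  rw [Measure.support_eq_forall_isOpen]
  ext x
  exact forall_congr' fun U => forall_comm

lemma measure_eq_dirac {μ : Measure X} [IsProbabilityMeasure μ] {p : X}
    (h : ∀ᵐ y ∂μ, y = p) : μ = Measure.dirac p := by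
  have := Measure.map_congr (mβ := ‹MeasurableSpace X›) (f := id) (g := fun _ => p) h
  simpa using this

lemma mem_PC_of_eq_dirac {p : X} (hp : p ∈ C) (hC : MeasurableSet C) {η : ProbabilityMeasure X}
    (h : (η : Measure X) = Measure.dirac p) : η ∈ PC C := by
  simp [PC, h, Measure.dirac_apply' _ hC.compl, hp]

lemma UniqueMinimizerCondition.eq (huniq : UniqueMinimizerCondition F C)
    {η : ProbabilityMeasure X} (hη : η ∈ PC C) {p q : X} (hp : p ∈ argminSet F C η)
    (hq : q ∈ argminSet F C η) : p = q :=
  (huniq η hη).unique hp hq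

lemma isEquilibrium_iff (hC : MeasurableSet C) (huniq : UniqueMinimizerCondition F C)
    {η : ProbabilityMeasure X} :
    IsEquilibrium F C η ↔ ∃ p ∈ argminSet F C η, (η : Measure X) = Measure.dirac p := by
  have : SecondCountableTopology X := UniformSpace.secondCountable_of_separable X
  constructor
  · rintro ⟨hη, hsupp⟩
    obtain ⟨p, hp, hpu⟩ := huniq η hη
    refine ⟨p, hp, measure_eq_dirac ?_⟩
    filter_upwards [Measure.support_mem_ae (μ := (η : Measure X))] with y hy
    exact hpu y (hsupp (by rwa [msupp_eq_support]))
  · rintro ⟨p, hp, h⟩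
    refine ⟨mem_PC_of_eq_dirac hp.1 hC h, fun y hy => ?_⟩
    have : y = p := by
      by_contra hne
      have := hy {p}ᶜ isOpen_compl_singleton hne
      simp [h] at this
    exact this ▸ hp

lemma dirac_equilibrium_unique (hC : MeasurableSet C) (hmono : MonotoneMFG F C)
    (huniq : UniqueMinimizerCondition F C) {μ ν : ProbabilityMeasure X} {p q : X}
    (hμ : (μ : Measure X) = Measure.dirac p) (hν : (ν : Measure X) = Measure.dirac q)
    (hp : p ∈ argminSet F C μ) (hq : q ∈ argminSet F C ν) : p = q := by
  have hμC := mem_PC_of_eq_dirac hp.1 hC hμ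
  have h := hmono μ hμC ν (mem_PC_of_eq_dirac hq.1 hC hν)
  rw [hμ, hν, integral_dirac, integral_dirac] at h
  have h₁ := hp.2 q hq.1
  have h₂ := hq.2 p hp.1
  refine huniq.eq hμC hp ⟨hq.1, fun y hy => ?_⟩
  linarith [hp.2 y hy]

lemma eq_dirac_of_integral_le (hC : IsCompact C) (huniq : UniqueMinimizerCondition F C)
    {μ : ProbabilityMeasure X} (hμ : μ ∈ PC C) (hF : ContinuousOn (fun y => F y μ) C) {p : X}
    (hp : p ∈ argminSet F C μ) (h : ∫ y, F y μ ∂(μ : Measure X) ≤ F p μ) :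
    (μ : Measure X) = Measure.dirac p := by
  have hint := integrable_of_continuousOn hC hF hμ
  have hnn : 0 ≤ᵐ[(μ : Measure X)] fun y => F y μ - F p μ :=
    (ae_mem_of_mem_PC hμ).mono fun y hy => sub_nonneg.2 (hp.2 y hy)
  have hzero : ∫ y, (F y μ - F p μ) ∂(μ : Measure X) = 0 := by
    refine le_antisymm ?_ (integral_nonneg_of_ae hnn)
    rw [integral_sub hint (integrable_const _)]
    simpa using h
  refine measure_eq_dirac ?_
  filter_upwards [(integral_eq_zero_iff_of_nonneg_ae hnn (hint.sub (integrable_const _))).1 hzero,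
    ae_mem_of_mem_PC hμ] with y hy hyC
  refine huniq.eq hμ ⟨hyC, fun z hz => ?_⟩ hp
  have := hp.2 z hz
  simp only [Pi.zero_apply] at hy
  linarith

end Equilibrium

section Continuity

variable {C : Set X} {F : X → ProbabilityMeasure X → ℝ} {ι : Type*} {l : Filter ι}
  {m : ι → ProbabilityMeasure X} {μ : ProbabilityMeasure X}

lemma continuousOn_left
    (hF : ContinuousOn (fun p : X × ProbabilityMeasure X => F p.1 p.2) (C ×ˢ PC C))
    (hμ : μ ∈ PC C) : ContinuousOn (fun y => F y μ) C :=
  hF.comp (f := fun y => (y, μ)) (by fun_prop) fun _ hy => ⟨hy, hμ⟩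

lemma tendsto_cost
    (hF : ContinuousOn (fun p : X × ProbabilityMeasure X => F p.1 p.2) (C ×ˢ PC C))
    {x : ι → X} {p : X} (hx : ∀ᶠ i in l, x i ∈ C) (hm : ∀ᶠ i in l, m i ∈ PC C) (hp : p ∈ C)
    (hμ : μ ∈ PC C) (hxp : Tendsto x l (𝓝 p)) (hmμ : Tendsto m l (𝓝 μ)) :
    Tendsto (fun i => F (x i) (m i)) l (𝓝 (F p μ)) :=
  (hF (p, μ) ⟨hp, hμ⟩).tendsto.comp
    (tendsto_nhdsWithin_iff.2 ⟨hxp.prodMk_nhds hmμ, hx.and hm⟩)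

lemma mem_argminSet_of_tendsto [l.NeBot]
    (hF : ContinuousOn (fun p : X × ProbabilityMeasure X => F p.1 p.2) (C ×ˢ PC C))
    {x : ι → X} {p : X} (hx : ∀ᶠ i in l, x i ∈ argminSet F C (m i))
    (hm : ∀ᶠ i in l, m i ∈ PC C) (hp : p ∈ C) (hμ : μ ∈ PC C) (hxp : Tendsto x l (𝓝 p))
    (hmμ : Tendsto m l (𝓝 μ)) : p ∈ argminSet F C μ :=
  ⟨hp, fun y hy => le_of_tendsto_of_tendsto
    (tendsto_cost hF (hx.mono fun _ h => h.1) hm hp hμ hxp hmμ)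
    (tendsto_cost hF (Eventually.of_forall fun _ => hy) hm hy hμ tendsto_const_nhds hmμ)
    (hx.mono fun _ h => h.2 y hy)⟩

lemma eventually_cost_lt (hC : IsCompact C)
    (hF : ContinuousOn (fun p : X × ProbabilityMeasure X => F p.1 p.2) (C ×ˢ PC C))
    (hm : ∀ᶠ i in l, m i ∈ PC C) (hμ : μ ∈ PC C) (hmμ : Tendsto m l (𝓝 μ)) {ε : ℝ}
    (hε : 0 < ε) : ∀ᶠ i in l, ∀ y ∈ C, |F y (m i) - F y μ| < ε := by
  have hF' : ContinuousOn (Function.uncurry fun (ν : ProbabilityMeasure X) (y : X) => F y ν)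
      (PC C ×ˢ C) :=
    hF.comp (f := fun q : ProbabilityMeasure X × X => (q.2, q.1)) (by fun_prop)
      fun _ hq => ⟨hq.2, hq.1⟩
  obtain ⟨v, hv, h⟩ := hC.mem_uniformity_of_prod hF' hμ (Metric.dist_mem_uniformity hε)
  exact ((tendsto_nhdsWithin_iff.2 ⟨hmμ, hm⟩).eventually hv).mono fun _ hi => h _ hi

/-- If the exploitability vanishes along a convergent family, the limit has none either. -/
lemma integral_cost_le_of_tendsto [l.NeBot] (hC : IsCompact C)
    (hF : ContinuousOn (fun p : X × ProbabilityMeasure X => F p.1 p.2) (C ×ˢ PC C))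
    {x : ι → X} {p : X} (hx : ∀ᶠ i in l, x i ∈ C)
    (hm : ∀ᶠ i in l, m i ∈ PC C) (hp : p ∈ C) (hμ : μ ∈ PC C) (hxp : Tendsto x l (𝓝 p))
    (hmμ : Tendsto m l (𝓝 μ))
    (hφ : Tendsto (fun i => ∫ y, F y (m i) ∂(m i : Measure X) - F (x i) (m i)) l (𝓝 0)) :
    ∫ y, F y μ ∂(μ : Measure X) ≤ F p μ := by
  refine le_of_forall_pos_le_add fun ε hε => ?_
  have h₁ := tendsto_integral_of_continuousOn hC (continuousOn_left hF hμ) hm hμ hmμ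
  have h₂ := (hφ.add (tendsto_cost hF hx hm hp hμ hxp hmμ)).add_const ε
  rw [zero_add] at h₂
  refine le_of_tendsto_of_tendsto h₁ h₂ ?_
  filter_upwards [hm, eventually_cost_lt hC hF hm hμ hmμ hε] with i hi hlt
  have hint := integrable_of_continuousOn hC (continuousOn_left hF hi) hi
  have : ∫ y, F y μ ∂(m i : Measure X) ≤ ∫ y, (F y (m i) + ε) ∂(m i : Measure X) := by
    refine integral_mono_ae (integrable_of_continuousOn hC (continuousOn_left hF hμ) hi)
      (hint.add (integrable_const _)) ?_
    filter_upwards [ae_mem_of_mem_PC hi] with y hy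
    linarith [(abs_lt.1 (hlt y hy)).1]
  rw [integral_add hint (integrable_const _)] at this
  simp only [integral_const, probReal_univ, smul_eq_mul, one_mul] at this
  linarith

end Continuity

/-- One step of fictitious play contracts the exploitability, up to an error controlled by the
distance between consecutive best responses. -/
lemma exploitability_step {C : Set X} (hC : IsCompact C) {F : X → ProbabilityMeasure X → ℝ}
    (hF : ContinuousOn (fun p : X × ProbabilityMeasure X => F p.1 p.2) (C ×ˢ PC C))
    (hmono : MonotoneMFG F C) {K : ℝ} (hK : 0 < K)
    (hFcross : ∀ x₁ ∈ C, ∀ x₂ ∈ C, ∀ η₁ ∈ PC C, ∀ η₂ ∈ PC C,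
      |F x₁ η₁ - F x₁ η₂ - F x₂ η₁ + F x₂ η₂| ≤
        K * dist x₁ x₂ * W1 (η₁ : Measure X) (η₂ : Measure X))
    {μ ν : ProbabilityMeasure X} (hμ : μ ∈ PC C) (hν : ν ∈ PC C) {p q : X}
    (hp : p ∈ argminSet F C μ) (hq : q ∈ argminSet F C ν) {t s : ℝ≥0∞} (hts : t + s = 1)
    (hs : s ≠ 0) (hmix : (ν : Measure X) = t • (μ : Measure X) + s • Measure.dirac p) :
    ∫ y, F y ν ∂(ν : Measure X) - F q ν ≤
      t.toReal * (∫ y, F y μ ∂(μ : Measure X) - F p μ) +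
        s.toReal * (K * Metric.diam C * dist p q) := by
  have ht_top : t ≠ ∞ := fun h => by simp [h] at hts
  have hs_top : s ≠ ∞ := fun h => by simp [h] at hts
  have hs_pos : 0 < s.toReal := ENNReal.toReal_pos hs hs_top
  have hts' : t.toReal + s.toReal = 1 := by
    rw [← ENNReal.toReal_add ht_top hs_top, hts, ENNReal.toReal_one]
  have hFμ := integrable_of_continuousOn hC (continuousOn_left hF hμ) hμ
  have hFν := integrable_of_continuousOn hC (continuousOn_left hF hν) hμ
  have hdist := integrable_of_continuousOn hC
    (f := fun y => dist y p) (by fun_prop) hμ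
  have hW : W1 (μ : Measure X) (ν : Measure X) ≤ s.toReal * Metric.diam C := by
    rw [hmix]
    refine (W1_mixture_dirac_le hts hdist).trans ?_
    gcongr
    have : ∫ y, dist y p ∂(μ : Measure X) ≤ ∫ _, Metric.diam C ∂(μ : Measure X) := by
      refine integral_mono_ae hdist (integrable_const _) ?_
      filter_upwards [ae_mem_of_mem_PC hμ] with y hy
      exact Metric.dist_le_diam_of_mem hC.isBounded hy hp.1
    simpa using this
  have hcross : F p ν - F p μ - (F q ν - F q μ) ≤ K * dist p q * (s.toReal * Metric.diam C) := by
    have h₁ := (abs_le.1 (hFcross p hp.1 q hq.1 μ hμ ν hν)).1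
    have h₂ := mul_le_mul_of_nonneg_left hW (mul_nonneg hK.le (dist_nonneg (x := p) (y := q)))
    linarith
  have hmon := hmono ν hν μ hμ
  rw [hmix, integral_mixture_dirac ht_top hs_top (f := fun y => F y ν - F y μ) (hFν.sub hFμ), integral_sub hFν hFμ] at hmon
  rw [show ∫ y, F y ν ∂(ν : Measure X) =
      t.toReal * ∫ y, F y ν ∂(μ : Measure X) + s.toReal * F p ν by
    conv_lhs => rw [hmix]
    exact integral_mixture_dirac ht_top hs_top hFν]
  have ht : t.toReal = 1 - s.toReal := by linarith
  have hbr : ∫ y, F y ν ∂(μ : Measure X) - ∫ y, F y μ ∂(μ : Measure X) ≤ F p ν - F p μ := by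
    rw [ht] at hmon
    refine le_of_mul_le_mul_left ?_ hs_pos
    linarith
  have hqp := hp.2 q hq.1
  have := mul_le_mul_of_nonneg_left hbr (ENNReal.toReal_nonneg (a := t))
  rw [ht] at this ⊢
  linarith

/-- If `n ↦ n φ_n` grows by at most a vanishing sequence, then `φ_n` tends to `0`. -/
lemma tendsto_zero_of_step {φ e : ℕ → ℝ} (hφ : ∀ n, 0 ≤ φ n) (he : Tendsto e atTop (𝓝 0))
    (hstep : ∀ n : ℕ, ((n : ℝ) + 2) * φ (n + 1) ≤ ((n : ℝ) + 1) * φ n + e n) :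
    Tendsto φ atTop (𝓝 0) := by
  have hsum : ∀ n : ℕ, ((n : ℝ) + 1) * φ n ≤ φ 0 + ∑ i ∈ Finset.range n, e i := by
    intro n
    induction n with
    | zero => simp
    | succ n ih =>
      rw [Finset.sum_range_succ]
      push_cast
      linarith [hstep n]
  have hlim : Tendsto (fun n : ℕ => (n : ℝ)⁻¹ * φ 0 + (n : ℝ)⁻¹ * ∑ i ∈ Finset.range n, e i)
      atTop (𝓝 0) := by
    simpa using (tendsto_inv_atTop_nhds_zero_nat.mul_const (φ 0)).add he.cesaro
  refine tendsto_of_tendsto_of_tendsto_of_le_of_le' tendsto_const_nhds hlim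
    (Eventually.of_forall hφ) ?_
  filter_upwards [eventually_gt_atTop 0] with n hn
  have hn' : (0 : ℝ) < n := Nat.cast_pos.2 hn
  rw [← mul_add, inv_mul_eq_div, le_div_iff₀ hn']
  linarith [hsum n, hφ n]

/-- Averaging a vanishing Dirac mass into a convergent family does not change its limit. -/
lemma tendsto_mixture_dirac {ι : Type*} {l : Filter ι} {m m' : ι → ProbabilityMeasure X}
    {μ : ProbabilityMeasure X} {x : ι → X} {t s : ι → ℝ≥0∞} (hts : ∀ i, t i + s i = 1)
    (hs : Tendsto (fun i => (s i).toReal) l (𝓝 0))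
    (hmix : ∀ i, (m' i : Measure X) = t i • (m i : Measure X) + s i • Measure.dirac (x i))
    (hm : Tendsto m l (𝓝 μ)) : Tendsto m' l (𝓝 μ) := by
  rw [ProbabilityMeasure.tendsto_iff_forall_integral_tendsto] at hm ⊢
  intro f
  have ht_top : ∀ i, t i ≠ ∞ := fun i h => by simpa [h] using hts i
  have hs_top : ∀ i, s i ≠ ∞ := fun i h => by simpa [h] using hts i
  have ht : ∀ i, (t i).toReal = 1 - (s i).toReal := fun i => by
    rw [eq_sub_iff_add_eq, ← ENNReal.toReal_add (ht_top i) (hs_top i), hts, ENNReal.toReal_one]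
  have hbdd : IsBoundedUnder (· ≤ ·) l fun i => ‖f (x i)‖ :=
    isBoundedUnder_of ⟨‖f‖, fun i => f.norm_coe_le_norm _⟩
  have h := (((tendsto_const_nhds (x := (1 : ℝ))).sub hs).mul (hm f)).add
    (hs.zero_mul_isBoundedUnder_le hbdd)
  rw [sub_zero, one_mul, add_zero] at h
  refine h.congr fun i => ?_
  rw [hmix i, integral_mixture_dirac (ht_top i) (hs_top i) (f.integrable _), ht i]

/-- Convergence of the fictitious play procedure (Theorem 3.4 of the paper). -/
theorem fictitious_play_convergence_general
    (C : Set X) (hC : IsCompact C) (hCne : C.Nonempty)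
    (F : X → ProbabilityMeasure X → ℝ)
    (hFcont : ContinuousOn (fun p : X × ProbabilityMeasure X => F p.1 p.2) (C ×ˢ PC C))
    (hmono : MonotoneMFG F C) (huniq : UniqueMinimizerCondition F C)
    -- `F` is Lipschitz on `C × P(C)` (with `P(C)` endowed with `d₁`)
    (L : ℝ) (hL : 0 < L)
    (hFLip : ∀ x₁ ∈ C, ∀ x₂ ∈ C, ∀ η₁ ∈ PC C, ∀ η₂ ∈ PC C,
      |F x₁ η₁ - F x₂ η₂| ≤ L * (dist x₁ x₂ + W1 (η₁ : Measure X) (η₂ : Measure X)))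
    -- the cross estimate with constant `K`
    (K : ℝ) (hK : 0 < K)
    (hFcross : ∀ x₁ ∈ C, ∀ x₂ ∈ C, ∀ η₁ ∈ PC C, ∀ η₂ ∈ PC C,
      |F x₁ η₁ - F x₁ η₂ - F x₂ η₁ + F x₂ η₂| ≤
        K * dist x₁ x₂ * W1 (η₁ : Measure X) (η₂ : Measure X))
    -- the fictitious play sequence
    (x : ℕ → X) (η : ℕ → ProbabilityMeasure X)
    (hx₁ : x 1 ∈ C) (hη₁ : (η 1 : Measure X) = Measure.dirac (x 1))
    (hbr : ∀ n : ℕ, 1 ≤ n → x (n + 1) ∈ C ∧ ∀ y ∈ C, F (x (n + 1)) (η n) ≤ F y (η n))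
    (hrec : ∀ n : ℕ, 1 ≤ n → (η (n + 1) : Measure X) =
      ((n : ℝ≥0∞) / (n + 1)) • (η n : Measure X) +
        ((n : ℝ≥0∞) + 1)⁻¹ • Measure.dirac (x (n + 1))) :
    ∃ xt ∈ C,
      (∀ ηt : ProbabilityMeasure X,
        IsEquilibrium F C ηt ↔ (ηt : Measure X) = Measure.dirac xt) ∧
      Tendsto x atTop (𝓝 xt) ∧
      Tendsto (fun n => W1 (η n : Measure X) (Measure.dirac xt)) atTop (𝓝 0) := by
  have hCm := hC.measurableSet
  have hx : ∀ n, x (n + 2) ∈ argminSet F C (η (n + 1)) := fun n => hbr (n + 1) (by omega)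
  have hxC : ∀ n, x (n + 1) ∈ C
    | 0 => hx₁
    | n + 1 => (hx n).1
  -- the weights, indexed from the first measure
  let t : ℕ → ℝ≥0∞ := fun n => ((n : ℝ≥0∞) + 1) / ((n : ℝ≥0∞) + 1 + 1)
  let s : ℕ → ℝ≥0∞ := fun n => ((n : ℝ≥0∞) + 1 + 1)⁻¹
  have hts : ∀ n, t n + s n = 1 := fun n => by
    simp only [t, s]
    rw [div_eq_mul_inv, ← add_one_mul]
    exact ENNReal.mul_inv_cancel (by simp) (by finiteness)
  have hs0 : ∀ n, s n ≠ 0 := fun n => ENNReal.inv_ne_zero.2 (by finiteness)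
  have hcast₁ : ∀ n : ℕ, ((n : ℝ≥0∞) + 1).toReal = (n : ℝ) + 1 := fun n => by
    simpa using ENNReal.toReal_natCast (n + 1)
  have hcast₂ : ∀ n : ℕ, ((n : ℝ≥0∞) + 1 + 1).toReal = (n : ℝ) + 2 := fun n => by
    have := hcast₁ (n + 1)
    push_cast at this
    linarith
  have htr : ∀ n, (t n).toReal = ((n : ℝ) + 1) / ((n : ℝ) + 2) := fun n => by
    simp only [t]
    rw [ENNReal.toReal_div, hcast₁, hcast₂]
  have hsr : ∀ n, (s n).toReal = ((n : ℝ) + 2)⁻¹ := fun n => by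
    simp only [s]
    rw [ENNReal.toReal_inv, hcast₂]
  have hmix : ∀ n, (η (n + 1 + 1) : Measure X) =
      t n • (η (n + 1) : Measure X) + s n • Measure.dirac (x (n + 2)) := fun n => by
    have := hrec (n + 1) (by omega)
    push_cast at this
    exact this
  have hηC : ∀ n, η (n + 1) ∈ PC C := fun n => by
    induction n with
    | zero => exact mem_PC_of_eq_dirac hx₁ hCm hη₁
    | succ n ih =>
      have h0 : (η (n + 1) : Measure X) Cᶜ = 0 := ih
      simp [PC, hmix n, h0, Measure.dirac_apply' _ hCm.compl, hxC (n + 1)]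
  have hs_lim : Tendsto (fun n => (s n).toReal) atTop (𝓝 0) := by
    have := (tendsto_add_atTop_iff_nat 2).2 (tendsto_inv_atTop_nhds_zero_nat (𝕜 := ℝ))
    refine this.congr fun n => ?_
    rw [hsr]
    push_cast
    rfl
  -- limits along ultrafilters
  have hcluster : ∀ U : Ultrafilter ℕ, ↑U ≤ (atTop : Filter ℕ) → ∃ m ∈ PC C, ∃ p ∈ argminSet F C m,
      Tendsto (fun n => η (n + 1)) U (𝓝 m) ∧ Tendsto (fun n => x (n + 2)) U (𝓝 p) ∧
        Tendsto (fun n => x (n + 3)) U (𝓝 p) := fun U hU => by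
    obtain ⟨m, hm, hηm⟩ := (isCompact_PC hC).ultrafilter_le_nhds' (U.map fun n => η (n + 1))
      (Ultrafilter.mem_map.2 <| univ_mem' hηC)
    obtain ⟨p, hp, hxp⟩ := hC.ultrafilter_le_nhds' (U.map fun n => x (n + 2))
      (Ultrafilter.mem_map.2 <| univ_mem' fun n => hxC (n + 1))
    obtain ⟨q, hq, hxq⟩ := hC.ultrafilter_le_nhds' (U.map fun n => x (n + 3))
      (Ultrafilter.mem_map.2 <| univ_mem' fun n => hxC (n + 2))
    have hηm' : Tendsto (fun n => η (n + 1 + 1)) U (𝓝 m) :=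
      tendsto_mixture_dirac hts (hs_lim.mono_left hU) hmix hηm
    have hpm := mem_argminSet_of_tendsto hFcont (Eventually.of_forall hx)
      (Eventually.of_forall hηC) hp hm hxp hηm
    have hqm := mem_argminSet_of_tendsto hFcont (Eventually.of_forall fun n => hx (n + 1))
      (Eventually.of_forall fun n => hηC (n + 1)) hq hm hxq hηm'
    exact ⟨m, hm, p, hpm, hηm, hxp, huniq.eq hm hqm hpm ▸ hxq⟩
  have hdist : Tendsto (fun n => dist (x (n + 2)) (x (n + 3))) atTop (𝓝 0) := by
    refine (tendsto_iff_ultrafilter _ _ _).2 fun U hU => ?_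
    obtain ⟨m, -, p, -, -, h₁, h₂⟩ := hcluster U hU
    simpa using h₁.dist h₂
  let φ : ℕ → ℝ := fun n =>
    ∫ y, F y (η (n + 1)) ∂(η (n + 1) : Measure X) - F (x (n + 2)) (η (n + 1))
  have hφ_lim : Tendsto φ atTop (𝓝 0) := by
    refine tendsto_zero_of_step (e := fun n => K * Metric.diam C * dist (x (n + 2)) (x (n + 3)))
      (fun n => ?_) (by simpa using hdist.const_mul (K * Metric.diam C)) fun n => ?_
    · have : ∫ _, F (x (n + 2)) (η (n + 1)) ∂(η (n + 1) : Measure X) ≤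
          ∫ y, F y (η (n + 1)) ∂(η (n + 1) : Measure X) := by
        refine integral_mono_ae (integrable_const _)
          (integrable_of_continuousOn hC (continuousOn_left hFcont (hηC n)) (hηC n)) ?_
        filter_upwards [ae_mem_of_mem_PC (hηC n)] with y hy
        exact (hx n).2 y hy
      exact sub_nonneg.2 (by simpa using this)
    · have h : φ (n + 1) ≤ (t n).toReal * φ n +
          (s n).toReal * (K * Metric.diam C * dist (x (n + 2)) (x (n + 3))) :=
        exploitability_step hC hFcont hmono hK hFcross (hηC n) (hηC (n + 1)) (hx n) (hx (n + 1))
          (hts n) (hs0 n) (hmix n)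
      rw [htr, hsr] at h
      have hn : (0 : ℝ) < (n : ℝ) + 2 := by positivity
      refine (mul_le_mul_of_nonneg_left h hn.le).trans_eq ?_
      field_simp
  have hcluster_eq : ∀ U : Ultrafilter ℕ, ↑U ≤ (atTop : Filter ℕ) → ∃ m ∈ PC C,
      ∃ p ∈ argminSet F C m, (m : Measure X) = Measure.dirac p ∧
        Tendsto (fun n => η (n + 1)) U (𝓝 m) ∧ Tendsto (fun n => x (n + 2)) U (𝓝 p) :=
    fun U hU => by
      obtain ⟨m, hm, p, hp, hηm, hxp, -⟩ := hcluster U hU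
      refine ⟨m, hm, p, hp, eq_dirac_of_integral_le hC huniq hm (continuousOn_left hFcont hm) hp ?_,
        hηm, hxp⟩
      exact integral_cost_le_of_tendsto hC hFcont (Eventually.of_forall fun n => hxC (n + 1))
        (Eventually.of_forall hηC) hp.1 hm hxp hηm (hφ_lim.mono_left hU)
  obtain ⟨μ, hμ, p, hp, hμp, -, -⟩ := hcluster_eq (Ultrafilter.of atTop) (Ultrafilter.of_le _)
  have hlim : ∀ U : Ultrafilter ℕ, ↑U ≤ (atTop : Filter ℕ) →
      Tendsto (fun n => η (n + 1)) U (𝓝 μ) ∧ Tendsto (fun n => x (n + 2)) U (𝓝 p) :=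
    fun U hU => by
      obtain ⟨m, -, q, hq, hmq, hηm, hxq⟩ := hcluster_eq U hU
      obtain rfl := dirac_equilibrium_unique hCm hmono huniq hμp hmq hp hq
      obtain rfl : m = μ := Subtype.ext (hmq.trans hμp.symm)
      exact ⟨hηm, hxq⟩
  refine ⟨p, hp.1, fun ηt => ?_, ?_, ?_⟩
  · rw [isEquilibrium_iff hCm huniq]
    constructor
    · rintro ⟨q, hq, h⟩
      rwa [dirac_equilibrium_unique hCm hmono huniq hμp h hp hq]
    · intro h
      obtain rfl : ηt = μ := Subtype.ext (h.trans hμp.symm)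
      exact ⟨p, hp, h⟩
  · rw [← tendsto_add_atTop_iff_nat 2]
    exact (tendsto_iff_ultrafilter _ _ _).2 fun U hU => (hlim U hU).2
  · rw [← tendsto_add_atTop_iff_nat 1]
    have hd : ContinuousOn (fun y => dist y p) C := by fun_prop
    have h := tendsto_integral_of_continuousOn hC hd (Eventually.of_forall hηC) hμ
      ((tendsto_iff_ultrafilter _ _ _).2 fun U hU => (hlim U hU).1)
    rw [hμp, integral_dirac, dist_self] at h
    refine squeeze_zero (fun n => W1_nonneg _ _) (fun n => ?_) h
    simpa using W1_mixture_dirac_le (t := 0) (s := 1) (zero_add 1)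
      (integrable_of_continuousOn hC hd (hηC n))
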